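/- Let X and Y be pointed metric spaces, 1 ≤ s < p < ∞ and 0 < q ≤ s. Then every Lipschitz map T : X → Y is Lipschitz (p,m^L(s;q))-summing; in particular Π^L_{(p,m^L(s;s))}(X,Y) = L(X,Y) = Π^L_{(p,m^L(s;q))}(X,Y), where L(X,Y) is the set of all Lipschitz maps from X to Y. -/

import Mathlib

open MeasureTheory ENNReal NNReal

noncomputable section

/-- The closed unit ball `B_{X^#}` of the Lipschitz dual of a pointed metric space `(X, x₀)`:
all Lipschitz functions `f : X → ℝ` with `f x₀ = 0` and Lipschitz constant at most `1`. -/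
def dualBall (X : Type*) [MetricSpace X] (x₀ : X) : Set (X → ℝ) :=
  {f | LipschitzWith 1 f ∧ f x₀ = 0}

/-- The strong `ℓ_p` norm `‖(σ,x',x'')|ℓ_p‖ = (Σ_j |σ_j|^p d(x'_j,x''_j)^p)^{1/p}`
(with the sup for `p = ∞`). -/
def strongNorm {X : Type*} [MetricSpace X] (p : ℝ≥0∞) {m : ℕ}
    (σ : Fin m → ℝ) (x' x'' : Fin m → X) : ℝ≥0∞ :=
  eLpNorm (fun j => σ j * dist (x' j) (x'' j)) p Measure.count

/-- The weak Lipschitz `ℓ_p` norm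
`‖(σ,x',x'')|ℓ_p^{L,w}‖ = sup_{f ∈ B_{X^#}} (Σ_j |σ_j|^p |f(x'_j) - f(x''_j)|^p)^{1/p}`. -/
def weakNorm {X : Type*} [MetricSpace X] (x₀ : X) (p : ℝ≥0∞) {m : ℕ}
    (σ : Fin m → ℝ) (x' x'' : Fin m → X) : ℝ≥0∞ :=
  ⨆ f ∈ dualBall X x₀, eLpNorm (fun j => σ j * (f (x' j) - f (x'' j))) p Measure.count

/-- The `q`-conjugate index `s'(q)`, determined by `1/s'(q) = 1/q - 1/s`. -/
def conjIdx (q s : ℝ≥0∞) : ℝ≥0∞ := (1 / q - 1 / s)⁻¹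

/-- The Lipschitz mixed `(s;q)`-norm
`m^L_{(s;q)}(σ,x',x'') = inf ‖τ|ℓ_{s'(q)}‖ ⬝ ‖(σ/τ,x',x'')|ℓ_s^{L,w}‖`,
the infimum over all finite sequences `τ` of nonzero reals. -/
def mixedNorm {X : Type*} [MetricSpace X] (x₀ : X) (s q : ℝ≥0∞) {m : ℕ}
    (σ : Fin m → ℝ) (x' x'' : Fin m → X) : ℝ≥0∞ :=
  ⨅ (τ : Fin m → ℝ) (_ : ∀ j, τ j ≠ 0),
    eLpNorm τ (conjIdx q s) Measure.count * weakNorm x₀ s (fun j => σ j / τ j) x' x''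

/-- `T` is Lipschitz `(m^L(s;q),p)`-summing:
`m^L_{(s;q)}(σ,Tx',Tx'') ≤ C ⬝ ‖(σ,x',x'')|ℓ_p^{L,w}‖` for all finite sequences. -/
def LipMixedP {X Y : Type*} [MetricSpace X] [MetricSpace Y] (x₀ : X) (y₀ : Y)
    (s q p : ℝ≥0∞) (T : X → Y) : Prop :=
  ∃ C : ℝ≥0, ∀ (m : ℕ) (σ : Fin m → ℝ) (x' x'' : Fin m → X),
    mixedNorm y₀ s q σ (T ∘ x') (T ∘ x'') ≤ C * weakNorm x₀ p σ x' x''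

/-- The norm `π^L_{(m^L(s;q),p)}(T)`, the least constant in the defining inequality. -/
def lipMixedPNorm {X Y : Type*} [MetricSpace X] [MetricSpace Y] (x₀ : X) (y₀ : Y)
    (s q p : ℝ≥0∞) (T : X → Y) : ℝ≥0∞ :=
  sInf {C : ℝ≥0∞ | ∀ (m : ℕ) (σ : Fin m → ℝ) (x' x'' : Fin m → X),
    mixedNorm y₀ s q σ (T ∘ x') (T ∘ x'') ≤ C * weakNorm x₀ p σ x' x''}

/-- `T` is Lipschitz `(p,m^L(s;q))`-summing:
`‖(σ,Tx',Tx'')|ℓ_p‖ ≤ C ⬝ m^L_{(s;q)}(σ,x',x'')` for all finite sequences. -/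
def LipPMixed {X Y : Type*} [MetricSpace X] [MetricSpace Y] (x₀ : X)
    (p s q : ℝ≥0∞) (T : X → Y) : Prop :=
  ∃ C : ℝ≥0, ∀ (m : ℕ) (σ : Fin m → ℝ) (x' x'' : Fin m → X),
    strongNorm p σ (T ∘ x') (T ∘ x'') ≤ C * mixedNorm x₀ s q σ x' x''

/-- The norm `π^L_{(p,m^L(s;q))}(T)`, the least constant in the defining inequality. -/
def lipPMixedNorm {X Y : Type*} [MetricSpace X] [MetricSpace Y] (x₀ : X)
    (p s q : ℝ≥0∞) (T : X → Y) : ℝ≥0∞ :=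
  sInf {C : ℝ≥0∞ | ∀ (m : ℕ) (σ : Fin m → ℝ) (x' x'' : Fin m → X),
    strongNorm p σ (T ∘ x') (T ∘ x'') ≤ C * mixedNorm x₀ s q σ x' x''}

/-- The Lipschitz constant of a map, as an element of `ℝ≥0∞` (equal to `∞` if the map is
not Lipschitz). -/
def lipConst {α β : Type*} [PseudoEMetricSpace α] [PseudoEMetricSpace β] (f : α → β) : ℝ≥0∞ :=
  ⨅ (K : ℝ≥0) (_ : LipschitzWith K f), (K : ℝ≥0∞)


open Classical in
lemma prob_avoid {V : Type*} (S D : Finset V) (hD : D ⊆ S) (p : ℝ) :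
    ∑ A ∈ S.powerset, (if Disjoint A D then p ^ A.card * (1 - p) ^ (S \ A).card else 0)
      = (1 - p) ^ D.card := by
  have h := Finset.prod_add (fun i => if i ∈ D then (0:ℝ) else p) (fun _ => 1 - p) S
  have h2 : ∏ i ∈ S, ((if i ∈ D then (0:ℝ) else p) + (1 - p)) = (1 - p) ^ D.card := by
    have : ∀ i ∈ S, ((if i ∈ D then (0:ℝ) else p) + (1 - p)) = if i ∈ D then (1 - p) else 1 := by
      intro i _; split_ifs <;> ring
    rw [Finset.prod_congr rfl this, Finset.prod_ite, Finset.prod_const, Finset.prod_const_one,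
      mul_one, Finset.filter_mem_eq_inter, Finset.inter_eq_right.2 hD]
  rw [← h2, h]
  refine Finset.sum_congr rfl fun A _ => ?_
  rw [Finset.prod_const]
  split_ifs with hd
  · congr 1
    rw [Finset.prod_congr rfl (g := fun _ => p), Finset.prod_const]
    intro i hi
    rw [if_neg (Finset.disjoint_left.1 hd hi)]
  · rw [Finset.not_disjoint_iff] at hd
    obtain ⟨i, hi, hi'⟩ := hd
    rw [Finset.prod_eq_zero hi (by simp [hi']), zero_mul]

open Classical in
lemma prob_event {V : Type*} (S B C : Finset V) (hB : B ⊆ S) (hC : C ⊆ S) (hBC : Disjoint B C)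
    (b : ℝ) (hb : 2 ≤ b) (t : ℕ) (hBc : (B.card : ℝ) ≤ b ^ (t+1)) (hCc : b ^ t ≤ C.card) :
    Real.exp (-2) / (2 * b) ≤
    ∑ A ∈ S.powerset, (if Disjoint A B ∧ ¬ Disjoint A C then
      ((b ^ (t+1))⁻¹) ^ A.card * (1 - (b ^ (t+1))⁻¹) ^ (S \ A).card else 0) := by
  set p := (b ^ (t+1))⁻¹ with hp
  have hM : 2 ≤ b ^ (t+1) := hb.trans (le_self_pow₀ (by linarith) (by omega))
  have hp0 : 0 < p := by positivity
  have hp2 : p ≤ 1/2 := by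
    rw [hp]; rw [inv_le_comm₀ (by positivity) (by norm_num)]; norm_num; exact hM
  have e1 := prob_avoid S B hB p
  have e2 := prob_avoid S (B ∪ C) (Finset.union_subset hB hC) p
  rw [Finset.card_union_of_disjoint hBC, pow_add] at e2
  have key : ∑ A ∈ S.powerset, (if Disjoint A B ∧ ¬ Disjoint A C then
      p ^ A.card * (1 - p) ^ (S \ A).card else 0) = (1-p)^B.card * (1 - (1-p)^C.card) := by
    rw [mul_sub, mul_one, ← e2, ← e1, ← Finset.sum_sub_distrib]
    refine Finset.sum_congr rfl fun A _ => ?_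
    by_cases h1 : Disjoint A B <;> by_cases h2 : Disjoint A C <;>
      simp [h1, h2, Finset.disjoint_union_right]
  rw [key]
  have hpM : p * b ^ (t+1) = 1 := inv_mul_cancel₀ (by positivity)
  have k1 : Real.exp (-2) ≤ (1-p)^B.card := by
    have : Real.exp (-(2*p)) ≤ 1 - p := by
      have h3 : 1 + 2 * p ≤ Real.exp (2*p) := by linarith [Real.add_one_le_exp (2*p)]
      rw [Real.exp_neg, inv_le_comm₀ (Real.exp_pos _) (by linarith)]
      refine le_trans ?_ h3
      rw [inv_le_iff_one_le_mul₀ (by linarith)]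
      nlinarith
    refine le_trans ?_ (pow_le_pow_left₀ (Real.exp_pos _).le this _)
    rw [← Real.exp_nat_mul]
    apply Real.exp_le_exp.2
    nlinarith
  have k2 : 1 / (2*b) ≤ 1 - (1-p)^C.card := by
    have h1 : 1 - p ≤ Real.exp (-p) := by linarith [Real.add_one_le_exp (-p)]
    have h2 : (1-p)^C.card ≤ Real.exp (-(1/b)) := by
      refine (pow_le_pow_left₀ (by linarith) h1 _).trans ?_
      rw [← Real.exp_nat_mul]
      apply Real.exp_le_exp.2
      have : 1 / b = b^t * p := by rw [hp, pow_succ]; field_simp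
      rw [this]; nlinarith
    have h3 : Real.exp (-(1/b)) ≤ 1 / (1 + 1/b) := by
      rw [Real.exp_neg, ← one_div]
      exact one_div_le_one_div_of_le (by positivity) (by linarith [Real.add_one_le_exp (1/b)])
    have h4 : 1 / (1 + 1/b) ≤ 1 - 1/(2*b) := by
      rw [div_le_iff₀ (by positivity)]
      have : 1/(2*b) = (1/b)/2 := by field_simp
      rw [this]
      have hb1 : 1/b ≤ 1/2 := one_div_le_one_div_of_le (by norm_num) hb
      have hb0 : 0 < 1/b := by positivity
      nlinarith
    linarith
  calc Real.exp (-2) / (2*b) = Real.exp (-2) * (1/(2*b)) := by ring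
    _ ≤ _ := mul_le_mul k1 k2 (by positivity) (pow_nonneg (by linarith) _)

open Classical in
/-- Main combinatorial lemma. -/
lemma exists_lip {X ι : Type*} [MetricSpace X] (x₀ : X) (k : ℕ) (hk : 0 < k) (J : Finset ι)
    (x y : ι → X) (hxy : ∀ j ∈ J, x j ≠ y j) (b : ℝ) (hb : 2 ≤ b) (hbk : 2 * (J.card : ℝ) ≤ b ^ k) :
    ∃ f : X → ℝ, LipschitzWith 1 f ∧ f x₀ = 0 ∧
      Real.exp (-2) / (2 * b) * J.card / k ≤
        ((J.filter fun j => dist (x j) (y j) ≤ 2 * k * |f (x j) - f (y j)|).card : ℝ) := by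
  set S : Finset X := J.image x ∪ J.image y with hS
  have hScard : (S.card : ℝ) ≤ b ^ k := by
    refine le_trans ?_ hbk
    have h1 := Finset.card_union_le (J.image x) (J.image y)
    have h2 := Finset.card_image_le (s := J) (f := x)
    have h3 := Finset.card_image_le (s := J) (f := y)
    have : S.card ≤ 2 * J.card := by rw [hS]; omega
    exact_mod_cast this
  let G : Finset X → Finset ι := fun A => J.filter fun j => dist (x j) (y j) ≤
    2 * k * |Metric.infDist (x j) (A : Set X) - Metric.infDist (y j) (A : Set X)|
  let w : ℕ → Finset X → ℝ := fun t A =>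
    ((b ^ (t+1))⁻¹) ^ A.card * (1 - (b ^ (t+1))⁻¹) ^ (S \ A).card
  have hw0 : ∀ t A, 0 ≤ w t A := by
    intro t A
    have : (b ^ (t+1))⁻¹ ≤ 1 := inv_le_one_of_one_le₀ (one_le_pow₀ (by linarith))
    exact mul_nonneg (by positivity) (pow_nonneg (by linarith) _)
  have hw1 : ∀ t, ∑ A ∈ S.powerset, w t A = 1 := by
    intro t
    have := prob_avoid S ∅ (by simp) ((b ^ (t+1))⁻¹)
    simpa [w] using this
  -- per pair
  have hpair : ∀ j ∈ J, ∃ t ∈ Finset.range k, Real.exp (-2) / (2*b) ≤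
      ∑ A ∈ S.powerset, (if j ∈ G A then w t A else 0) := by
    intro j hj
    have hd : 0 < dist (x j) (y j) := dist_pos.2 (hxy j hj)
    set d := dist (x j) (y j) with hdd
    have hk' : (0:ℝ) < k := by exact_mod_cast hk
    set δ := d / (2 * k) with hδ
    have hδ0 : 0 < δ := by positivity
    let c : ℕ → X := fun t => if Even t then x j else y j
    have hcc : ∀ t, dist (c t) (c (t+1)) = d := by
      intro t
      by_cases h : Even t
      · simp [c, h, Nat.even_add_one, hdd]
      · simp [c, h, Nat.even_add_one, hdd, dist_comm]
    let B : ℕ → Finset X := fun t => S.filter fun z => dist z (c t) ≤ t * δ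
    have ht : ∃ t ∈ Finset.range k, b ^ t ≤ (B t).card ∧ ((B (t+1)).card : ℝ) ≤ b ^ (t+1) := by
      by_contra! hcon
      have : ∀ t, t ≤ k → b ^ t ≤ (B t).card ∧ (0 < t → b ^ t < (B t).card) := by
        intro t
        induction t with
        | zero =>
          intro _
          refine ⟨?_, by simp⟩
          have : 0 < (B 0).card := Finset.card_pos.2 ⟨x j, by
            simp [B, c, hS]; exact Or.inl ⟨j, hj, rfl⟩⟩
          simp only [pow_zero]; exact_mod_cast this
        | succ t ih =>
          intro h
          have := hcon t (Finset.mem_range.2 h) (ih (by omega)).1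
          exact ⟨this.le, fun _ => this⟩
      have h1 := (this k le_rfl).2 hk
      have h2 : ((B k).card : ℝ) ≤ S.card := by exact_mod_cast Finset.card_filter_le _ _
      linarith
    obtain ⟨t, htk, h1, h2⟩ := ht
    refine ⟨t, htk, ?_⟩
    have htk' : (t:ℝ) + 1 ≤ k := by exact_mod_cast Finset.mem_range.1 htk
    have hdδ : d = 2 * k * δ := by rw [hδ]; field_simp
    have hdisj : Disjoint (B (t+1)) (B t) := by
      rw [Finset.disjoint_left]
      intro z hz hz'
      simp only [B, Finset.mem_filter] at hz hz'
      have := dist_triangle_left (c t) (c (t+1)) z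
      rw [hcc] at this
      have h3 := hz.2; have h4 := hz'.2
      push_cast at h3
      nlinarith
    refine (prob_event S (B (t+1)) (B t) (Finset.filter_subset _ _) (Finset.filter_subset _ _)
      hdisj b hb t h2 h1).trans ?_
    refine Finset.sum_le_sum fun A hA => ?_
    by_cases hev : Disjoint A (B (t+1)) ∧ ¬ Disjoint A (B t)
    swap
    · rw [if_neg hev]; split_ifs; exacts [hw0 _ _, le_rfl]
    rw [if_pos hev, if_pos]
    obtain ⟨ha, hb'⟩ := hev
    obtain ⟨z, hzA, hz⟩ := Finset.not_disjoint_iff.1 hb'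
    have u1 : Metric.infDist (c t) (A : Set X) ≤ t * δ := by
      refine (Metric.infDist_le_dist_of_mem (Finset.mem_coe.2 hzA)).trans ?_
      rw [dist_comm]; exact (Finset.mem_filter.1 hz).2
    have u2 : (t + 1) * δ ≤ Metric.infDist (c (t+1)) (A : Set X) := by
      rw [Metric.le_infDist ⟨z, Finset.mem_coe.2 hzA⟩]
      intro v hv
      by_contra! hlt
      refine Finset.disjoint_left.1 ha (Finset.mem_coe.1 hv) ?_
      refine Finset.mem_filter.2 ⟨Finset.mem_powerset.1 hA hv, ?_⟩
      rw [dist_comm]; push_cast; exact hlt.le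
    have u3 : δ ≤ |Metric.infDist (x j) (A : Set X) - Metric.infDist (y j) (A : Set X)| := by
      by_cases h : Even t
      · simp only [c, h, Nat.even_add_one, if_true, not_true, if_false] at u1 u2
        rw [abs_sub_comm]
        exact le_trans (by linarith) (le_abs_self _)
      · simp only [c, h, Nat.even_add_one, if_true, not_false_iff, if_false] at u1 u2
        exact le_trans (by linarith) (le_abs_self _)
    refine Finset.mem_filter.2 ⟨hj, ?_⟩
    rw [← hdd]
    calc d = 2 * k * δ := hdδ
      _ ≤ _ := by gcongr
  have hmain : ∃ A ∈ S.powerset, Real.exp (-2) / (2 * b) * J.card / k ≤ ((G A).card : ℝ) := by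
    by_contra! hcon
    set R := Real.exp (-2) / (2 * b) * J.card / k with hR
    have l1 : ∑ t ∈ Finset.range k, ∑ A ∈ S.powerset, w t A * (G A).card < k * R := by
      have : ∀ t ∈ Finset.range k, ∑ A ∈ S.powerset, w t A * (G A).card < R := by
        intro t _
        calc ∑ A ∈ S.powerset, w t A * (G A).card < ∑ A ∈ S.powerset, w t A * R := by
              refine Finset.sum_lt_sum
                (fun A hA => mul_le_mul_of_nonneg_left (hcon A hA).le (hw0 _ _)) ?_
              by_contra! hno
              have hz : ∀ A ∈ S.powerset, w t A = 0 := by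
                intro A hA
                have h1 := hno A hA
                have h2 := hcon A hA
                have h3 := hw0 t A
                nlinarith
              have := hw1 t
              rw [Finset.sum_eq_zero hz] at this
              norm_num at this
          _ = R := by rw [← Finset.sum_mul, hw1, one_mul]
      refine (Finset.sum_lt_sum_of_nonempty ⟨0, Finset.mem_range.2 hk⟩ this).trans_le ?_
      simp
    have l2 : (J.card : ℝ) * (Real.exp (-2) / (2*b)) ≤
        ∑ t ∈ Finset.range k, ∑ A ∈ S.powerset, w t A * (G A).card := by
      have : ∀ t A, w t A * (G A).card = ∑ j ∈ J, if j ∈ G A then w t A else 0 := by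
        intro t A
        rw [← Finset.sum_filter, Finset.sum_const, nsmul_eq_mul, mul_comm,
          Finset.filter_mem_eq_inter, Finset.inter_eq_right.2 (Finset.filter_subset _ _)]
      simp_rw [this]
      rw [Finset.sum_congr rfl fun t _ => Finset.sum_comm, Finset.sum_comm]
      rw [← nsmul_eq_mul]
      refine Finset.card_nsmul_le_sum _ _ _ fun j hj => ?_
      obtain ⟨t, ht, h⟩ := hpair j hj
      refine h.trans ?_
      refine Finset.single_le_sum (f := fun t => ∑ A ∈ S.powerset, if j ∈ G A then w t A else 0)
        (fun t _ => Finset.sum_nonneg fun A _ => ?_) ht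
      split_ifs; exacts [hw0 _ _, le_rfl]
    have : k * R = (J.card : ℝ) * (Real.exp (-2) / (2*b)) := by
      rw [hR]; field_simp
    linarith
  obtain ⟨A, _, hA⟩ := hmain
  refine ⟨fun z => Metric.infDist z (A : Set X) - Metric.infDist x₀ (A : Set X), ?_, by simp, ?_⟩
  · refine LipschitzWith.of_dist_le_mul fun u v => ?_
    have := (Metric.lipschitz_infDist_pt (A : Set X)).dist_le_mul u v
    simpa [Real.dist_eq] using this
  · simpa [G] using hA

lemma eLp_fin {m : ℕ} (f : Fin m → ℝ) (p : ℝ≥0∞) (hp0 : p ≠ 0) (hp : p ≠ ∞) :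
    eLpNorm f p Measure.count = (∑ j, ‖f j‖ₑ ^ p.toReal) ^ (1 / p.toReal) := by
  rw [eLpNorm_eq_lintegral_rpow_enorm_toReal hp0 hp, lintegral_count, tsum_fintype]

lemma le_weak {X : Type*} [MetricSpace X] (x₀ : X) (s : ℝ≥0∞) {m : ℕ} (σ : Fin m → ℝ)
    (x' x'' : Fin m → X) (f : X → ℝ) (hf : f ∈ dualBall X x₀) :
    eLpNorm (fun j => σ j * (f (x' j) - f (x'' j))) s Measure.count ≤ weakNorm x₀ s σ x' x'' := by
  unfold weakNorm
  exact le_iSup₂ (f := fun (f : X → ℝ) (_ : f ∈ dualBall X x₀) => eLpNorm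
    (fun j => σ j * (f (x' j) - f (x'' j))) s Measure.count) f hf

lemma enorm_le_eLp {m : ℕ} (f : Fin m → ℝ) (p : ℝ≥0∞) (hp0 : p ≠ 0) (j : Fin m) :
    ‖f j‖ₑ ≤ eLpNorm f p Measure.count := by
  by_cases hp : p = ∞
  · rw [hp, eLpNorm_exponent_top, eLpNormEssSup_count]
    exact le_iSup (fun j => ‖f j‖ₑ) j
  · have hP := ENNReal.toReal_pos hp0 hp
    rw [eLp_fin f p hp0 hp]
    calc ‖f j‖ₑ = (‖f j‖ₑ ^ p.toReal) ^ (1 / p.toReal) := by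
          rw [← ENNReal.rpow_mul, mul_one_div_cancel hP.ne', ENNReal.rpow_one]
      _ ≤ _ := by
          gcongr
          exact Finset.single_le_sum (f := fun j => ‖f j‖ₑ ^ p.toReal)
            (fun _ _ => zero_le) (Finset.mem_univ j)

open Classical in
lemma level_bound {X : Type*} [MetricSpace X] (x₀ : X) (s : ℝ≥0∞) (hs0 : s ≠ 0) (hs : s ≠ ∞)
    (k : ℕ) (hk : 0 < k) {m : ℕ} (σ : Fin m → ℝ) (x' x'' : Fin m → X) (J : Finset (Fin m))
    (hJ : J.Nonempty) (l : ℝ) (hl : 0 < l) (hlJ : ∀ j ∈ J, l ≤ |σ j| * dist (x' j) (x'' j)) :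
    ENNReal.ofReal (l / (2 * k) * (Real.exp (-2) / (4 * 2 ^ (1 / (k:ℝ)) * k) *
      (J.card : ℝ) ^ (1 - 1 / (k:ℝ))) ^ (1 / s.toReal)) ≤ weakNorm x₀ s σ x' x'' := by
  have hk' : (0:ℝ) < k := by exact_mod_cast hk
  have hN : (1:ℝ) ≤ J.card := by exact_mod_cast hJ.card_pos
  have hS : 0 < s.toReal := ENNReal.toReal_pos hs0 hs
  set b : ℝ := 2 * (2 * (J.card : ℝ)) ^ (1 / (k:ℝ)) with hb
  have hb1 : 1 ≤ (2 * (J.card : ℝ)) ^ (1 / (k:ℝ)) :=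
    Real.one_le_rpow (by linarith) (by positivity)
  have hbk : 2 * (J.card : ℝ) ≤ b ^ k := by
    have e : ((2 * (J.card : ℝ)) ^ (1 / (k:ℝ))) ^ k = 2 * J.card := by
      rw [← Real.rpow_natCast, ← Real.rpow_mul (by positivity)]
      rw [one_div_mul_cancel hk'.ne', Real.rpow_one]
    calc 2 * (J.card : ℝ) = ((2 * (J.card : ℝ)) ^ (1 / (k:ℝ))) ^ k := e.symm
      _ ≤ b ^ k := pow_le_pow_left₀ (by positivity) (by rw [hb]; linarith) _
  obtain ⟨f, hf, hf0, hcard⟩ := exists_lip x₀ k hk J x' x'' (by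
    intro j hj he
    have := hlJ j hj
    rw [he, dist_self, mul_zero] at this
    linarith) b (by rw [hb]; linarith) hbk
  set G := J.filter fun j => dist (x' j) (x'' j) ≤ 2 * k * |f (x' j) - f (x'' j)| with hG
  have hcard' : Real.exp (-2) / (4 * 2 ^ (1 / (k:ℝ)) * k) *
      (J.card : ℝ) ^ (1 - 1 / (k:ℝ)) ≤ G.card := by
    refine le_trans (le_of_eq ?_) hcard
    rw [hb, Real.mul_rpow (by norm_num) (by positivity), Real.rpow_sub (by linarith), Real.rpow_one]
    field_simp
    ring
  refine le_trans ?_ (le_weak x₀ s σ x' x'' f ⟨hf, hf0⟩)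
  rw [eLp_fin _ s hs0 hs]
  have hl2 : 0 < l / (2 * k) := by positivity
  calc ENNReal.ofReal (l / (2 * k) * (Real.exp (-2) / (4 * 2 ^ (1 / (k:ℝ)) * k) *
      (J.card : ℝ) ^ (1 - 1 / (k:ℝ))) ^ (1 / s.toReal))
      ≤ ENNReal.ofReal ((G.card * (l / (2 * k)) ^ s.toReal) ^ (1 / s.toReal)) := by
        apply ENNReal.ofReal_le_ofReal
        rw [Real.mul_rpow (x := (G.card : ℝ)) (by positivity) (by positivity), ← Real.rpow_mul hl2.le,
          mul_one_div_cancel hS.ne', Real.rpow_one, mul_comm]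
        exact mul_le_mul_of_nonneg_right (Real.rpow_le_rpow (by positivity) hcard' (by positivity)) hl2.le
    _ = (G.card * ENNReal.ofReal (l / (2 * k)) ^ s.toReal) ^ (1 / s.toReal) := by
        rw [← ENNReal.ofReal_rpow_of_nonneg (by positivity) (by positivity),
          ENNReal.ofReal_mul (by positivity), ENNReal.ofReal_natCast,
          ENNReal.ofReal_rpow_of_nonneg hl2.le hS.le]
    _ ≤ _ := by
        gcongr
        calc (G.card * ENNReal.ofReal (l / (2 * k)) ^ s.toReal : ℝ≥0∞)
            = ∑ j ∈ G, ENNReal.ofReal (l / (2 * k)) ^ s.toReal := by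
              rw [Finset.sum_const, nsmul_eq_mul]
          _ ≤ ∑ j ∈ G, ‖σ j * (f (x' j) - f (x'' j))‖ₑ ^ s.toReal := by
              refine Finset.sum_le_sum fun j hj => ?_
              gcongr
              rw [Real.enorm_eq_ofReal_abs]
              apply ENNReal.ofReal_le_ofReal
              obtain ⟨hjJ, hj2⟩ := Finset.mem_filter.1 hj
              rw [div_le_iff₀ (by positivity), abs_mul]
              calc l ≤ |σ j| * dist (x' j) (x'' j) := hlJ j hjJ
                _ ≤ |σ j| * (2 * k * |f (x' j) - f (x'' j)|) := by gcongr
                _ = _ := by ring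
          _ ≤ _ := Finset.sum_le_sum_of_subset (Finset.subset_univ _)

lemma strong_le_weak {X : Type*} [MetricSpace X] (x₀ : X) (s p : ℝ≥0∞) (hs0 : s ≠ 0)
    (hsp : s < p) (hp : p ≠ ∞) : ∃ C : ℝ≥0, ∀ (m : ℕ) (σ : Fin m → ℝ) (x' x'' : Fin m → X),
      strongNorm p σ x' x'' ≤ C * weakNorm x₀ s σ x' x'' := by
  have hs : s ≠ ∞ := (hsp.trans_le le_top).ne
  have hp0 : p ≠ 0 := (bot_le.trans_lt hsp).ne'
  have hS : 0 < s.toReal := ENNReal.toReal_pos hs0 hs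
  have hP : 0 < p.toReal := ENNReal.toReal_pos hp0 hp
  have hSP : s.toReal < p.toReal := (ENNReal.toReal_lt_toReal hs hp).2 hsp
  obtain ⟨n, hn⟩ := exists_nat_one_div_lt (K := ℝ) (ε := 1 - s.toReal / p.toReal)
    (by rw [sub_pos, div_lt_one hP]; exact hSP)
  set k := n + 1 with hk
  have hkn : (n:ℝ) + 1 = k := by rw [hk]; push_cast; rfl
  rw [hkn] at hn
  have hk' : (0:ℝ) < k := by rw [← hkn]; positivity
  set c0 : ℝ := Real.exp (-2) / (4 * 2 ^ (1 / (k:ℝ)) * k) with hc0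
  have hc0p : 0 < c0 := by positivity
  set κ : ℝ := c0 ^ (1 / s.toReal) / (2 * k) with hκ
  have hκp : 0 < κ := by positivity
  set β : ℝ := (1 - 1 / (k:ℝ)) * (1 / s.toReal) with hβ
  have hβp : 1 < β * p.toReal := by
    have h1 : s.toReal / p.toReal < 1 - 1 / (k:ℝ) := by linarith
    rw [div_lt_iff₀ hP] at h1
    rw [hβ, mul_assoc, mul_comm (1 / s.toReal), ← mul_assoc, mul_one_div, lt_div_iff₀ hS]
    linarith
  have hsum : Summable fun j : ℕ => (((j:ℝ) + 1) ^ (β * p.toReal))⁻¹ := by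
    have := (_root_.summable_nat_add_iff 1).2 (Real.summable_nat_rpow_inv.2 hβp)
    simpa using this
  set Z : ℝ := ∑' j : ℕ, (((j:ℝ) + 1) ^ (β * p.toReal))⁻¹ with hZ
  have hZ0 : 0 ≤ Z := tsum_nonneg fun j => by positivity
  refine ⟨((κ⁻¹ ^ p.toReal * Z) ^ (1 / p.toReal)).toNNReal, fun m σ x' x'' => ?_⟩
  set W := weakNorm x₀ s σ x' x'' with hW
  let a : Fin m → ℝ := fun j => |σ j| * dist (x' j) (x'' j)
  let π := Tuple.sort (fun j => - a j)
  have hπ : ∀ i j, i ≤ j → a (π j) ≤ a (π i) := fun i j hij => by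
    have := Tuple.monotone_sort (fun j => - a j) hij
    simpa using this
  have hbound : ∀ j : Fin m, ENNReal.ofReal (a (π j)) ≤
      ENNReal.ofReal (κ⁻¹ * (((j:ℕ):ℝ) + 1) ^ (-β)) * W := by
    intro j
    rcases le_or_gt (a (π j)) 0 with h0 | h0
    · rw [ENNReal.ofReal_of_nonpos h0]; exact zero_le
    have h := level_bound x₀ s hs0 hs k (by omega) σ x' x''
      ((Finset.Iic j).map π.toEmbedding) (by simp) (a (π j)) h0 (by
        intro i hi
        obtain ⟨i', hi', rfl⟩ := Finset.mem_map.1 hi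
        exact hπ i' j (Finset.mem_Iic.1 hi'))
    rw [Finset.card_map, Fin.card_Iic] at h
    push_cast at h
    rw [← hc0, Real.mul_rpow hc0p.le (by positivity), ← Real.rpow_mul (by positivity), ← hβ] at h
    have hJ : (0:ℝ) < (j:ℕ) + 1 := by positivity
    calc ENNReal.ofReal (a (π j)) = ENNReal.ofReal (κ⁻¹ * (((j:ℕ):ℝ) + 1) ^ (-β)) *
          ENNReal.ofReal (a (π j) / (2 * k) * (c0 ^ (1 / s.toReal) * (((j:ℕ):ℝ) + 1) ^ β)) := by
          rw [← ENNReal.ofReal_mul (by positivity)]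
          congr 1
          rw [Real.rpow_neg hJ.le, hκ]
          have : (((j:ℕ):ℝ) + 1) ^ β ≠ 0 := (Real.rpow_pos_of_pos hJ _).ne'
          have : c0 ^ (1 / s.toReal) ≠ 0 := (Real.rpow_pos_of_pos hc0p _).ne'
          field_simp
      _ ≤ _ := by gcongr
  rw [strongNorm, eLp_fin _ p hp0 hp]
  have e1 : ∑ j, ‖σ j * dist (x' j) (x'' j)‖ₑ ^ p.toReal =
      ∑ j, ENNReal.ofReal (a (π j)) ^ p.toReal := by
    rw [Equiv.sum_comp π (fun j => ENNReal.ofReal (a j) ^ p.toReal)]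
    refine Finset.sum_congr rfl fun j _ => ?_
    rw [Real.enorm_eq_ofReal_abs, abs_mul, abs_of_nonneg dist_nonneg]
  rw [e1]
  have e2 : ∑ j, ENNReal.ofReal (a (π j)) ^ p.toReal ≤
      ENNReal.ofReal (κ⁻¹ ^ p.toReal * Z) * W ^ p.toReal := by
    calc ∑ j, ENNReal.ofReal (a (π j)) ^ p.toReal
        ≤ ∑ j : Fin m, (ENNReal.ofReal (κ⁻¹ * (((j:ℕ):ℝ) + 1) ^ (-β)) * W) ^ p.toReal := by
          refine Finset.sum_le_sum fun j _ => ?_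
          gcongr
          exact hbound j
      _ = ∑ j : Fin m, ENNReal.ofReal (κ⁻¹ ^ p.toReal * (((((j:ℕ):ℝ) + 1) ^ (β * p.toReal))⁻¹))
            * W ^ p.toReal := by
          refine Finset.sum_congr rfl fun j _ => ?_
          rw [ENNReal.mul_rpow_of_nonneg _ _ hP.le, ENNReal.ofReal_rpow_of_nonneg (by positivity) hP.le,
            Real.mul_rpow (by positivity) (by positivity), ← Real.rpow_mul (by positivity), neg_mul,
            Real.rpow_neg (by positivity)]
      _ = ENNReal.ofReal (κ⁻¹ ^ p.toReal * ∑ j : Fin m, ((((j:ℕ):ℝ) + 1) ^ (β * p.toReal))⁻¹)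
            * W ^ p.toReal := by
          rw [← Finset.sum_mul, ← ENNReal.ofReal_sum_of_nonneg (fun j _ => by positivity),
            Finset.mul_sum]
      _ ≤ _ := by
          gcongr
          rw [Fin.sum_univ_eq_sum_range (fun j => (((j:ℝ) + 1) ^ (β * p.toReal))⁻¹) m]
          exact hsum.sum_le_tsum _ fun j _ => by positivity
  calc _ ≤ (ENNReal.ofReal (κ⁻¹ ^ p.toReal * Z) * W ^ p.toReal) ^ (1 / p.toReal) := by gcongr
    _ = _ := by
      rw [ENNReal.mul_rpow_of_nonneg _ _ (by positivity), ← ENNReal.rpow_mul,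
        mul_one_div_cancel hP.ne', ENNReal.rpow_one,
        ENNReal.ofReal_rpow_of_nonneg (by positivity) (by positivity)]
      rfl

lemma weak_le_mixed {X : Type*} [MetricSpace X] (x₀ : X) (s q : ℝ≥0∞) (hs0 : s ≠ 0)
    (hs : s ≠ ∞) {m : ℕ} (hq : 0 < q)
    (σ : Fin m → ℝ) (x' x'' : Fin m → X) : weakNorm x₀ s σ x' x'' ≤ mixedNorm x₀ s q σ x' x'' := by
  refine le_iInf₂ fun τ hτ => ?_
  have hτb : ∀ j, ‖τ j‖ₑ ≤ eLpNorm τ (conjIdx q s) Measure.count := by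
    intro j
    refine enorm_le_eLp τ _ ?_ j
    rw [conjIdx, ENNReal.inv_ne_zero]
    refine ENNReal.sub_ne_top ?_
    rw [one_div, ENNReal.inv_ne_top]
    exact hq.ne'
  refine iSup₂_le fun f hf => ?_
  refine le_trans ?_ (mul_le_mul_right (le_weak x₀ s (fun j => σ j / τ j) x' x'' f hf) _)
  have hS : 0 < s.toReal := ENNReal.toReal_pos hs0 hs
  rw [eLp_fin _ s hs0 hs, eLp_fin _ s hs0 hs]
  set M := eLpNorm τ (conjIdx q s) Measure.count
  calc _ ≤ (∑ j, (M * ‖σ j / τ j * (f (x' j) - f (x'' j))‖ₑ) ^ s.toReal) ^ (1 / s.toReal) := by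
        gcongr with j
        have : σ j * (f (x' j) - f (x'' j)) = τ j * (σ j / τ j * (f (x' j) - f (x'' j))) := by
          have := hτ j
          field_simp
        rw [this, enorm_mul]
        gcongr
        exact hτb j
    _ = _ := by
        simp_rw [ENNReal.mul_rpow_of_nonneg _ _ hS.le]
        rw [← Finset.mul_sum, ENNReal.mul_rpow_of_nonneg _ _ (by positivity), ← ENNReal.rpow_mul,
          mul_one_div_cancel hS.ne', ENNReal.rpow_one]

lemma lip_summing {X Y : Type*} [MetricSpace X] [MetricSpace Y] (x₀ : X)
    (s p q : ℝ≥0∞) (hs : 1 ≤ s) (hsp : s < p) (hp : p < ∞) (hq : 0 < q) (hqs : q ≤ s)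
    (T : X → Y) (hT : ∃ K : ℝ≥0, LipschitzWith K T) : LipPMixed x₀ p s q T := by
  obtain ⟨K, hK⟩ := hT
  have hs0 : s ≠ 0 := (one_pos.trans_le hs).ne'
  have hs' : s ≠ ∞ := (hsp.trans_le le_top).ne
  have hp0 : p ≠ 0 := (bot_le.trans_lt hsp).ne'
  obtain ⟨C, hC⟩ := strong_le_weak x₀ s p hs0 hsp hp.ne
  refine ⟨K * C, fun m σ x' x'' => ?_⟩
  have h1 : strongNorm p σ (T ∘ x') (T ∘ x'') ≤ K * strongNorm p σ x' x'' := by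
    rw [strongNorm, strongNorm]
    refine (eLpNorm_le_nnreal_smul_eLpNorm_of_ae_le_mul (c := K) (Filter.Eventually.of_forall fun j => ?_) p)
    have : ‖σ j * dist ((T ∘ x') j) ((T ∘ x'') j)‖ ≤ K * ‖σ j * dist (x' j) (x'' j)‖ := by
      rw [norm_mul, norm_mul, Real.norm_of_nonneg dist_nonneg, Real.norm_of_nonneg dist_nonneg]
      have := hK.dist_le_mul (x' j) (x'' j)
      calc _ ≤ ‖σ j‖ * (K * dist (x' j) (x'' j)) := by gcongr; exact this
        _ = _ := by ring
    exact_mod_cast this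
  calc _ ≤ K * strongNorm p σ x' x'' := h1
    _ ≤ K * (C * mixedNorm x₀ s q σ x' x'') := by
      gcongr
      exact (hC m σ x' x'').trans (by gcongr; exact weak_le_mixed x₀ s q hs0 hs' hq σ x' x'')
    _ = _ := by push_cast; ring

/-- for `1 ≤ s < p < ∞` and `0 < q ≤ s`, every Lipschitz map `T : X → Y` is
Lipschitz `(p,m^L(s;q))`-summing; in particular
`Π^L_{(p,m^L(s;s))}(X,Y) = L(X,Y) = Π^L_{(p,m^L(s;q))}(X,Y)`. -/
theorem stmt19 {X Y : Type*} [MetricSpace X] [MetricSpace Y] (x₀ : X)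
    (s p q : ℝ≥0∞) (hs : 1 ≤ s) (hsp : s < p) (hp : p < ∞) (hq : 0 < q) (hqs : q ≤ s) :
    (∀ T : X → Y, (∃ K : ℝ≥0, LipschitzWith K T) → LipPMixed x₀ p s q T) ∧
    {T : X → Y | (∃ K : ℝ≥0, LipschitzWith K T) ∧ LipPMixed x₀ p s s T}
      = {T : X → Y | ∃ K : ℝ≥0, LipschitzWith K T} ∧
    {T : X → Y | (∃ K : ℝ≥0, LipschitzWith K T) ∧ LipPMixed x₀ p s q T}
      = {T : X → Y | ∃ K : ℝ≥0, LipschitzWith K T} := by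
  have key : ∀ r : ℝ≥0∞, 0 < r → r ≤ s → ∀ T : X → Y, (∃ K : ℝ≥0, LipschitzWith K T) →
      LipPMixed x₀ p s r T := fun r hr hrs T hT => lip_summing x₀ s p r hs hsp hp hr hrs T hT
  refine ⟨key q hq hqs, ?_, ?_⟩
  · ext T
    exact ⟨fun h => h.1, fun h => ⟨h, key s (one_pos.trans_le hs) le_rfl T h⟩⟩
  · ext T
    exact ⟨fun h => h.1, fun h => ⟨h, key q hq hqs T h⟩⟩
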